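/- (Theorem 2(a)) Consider the distributed gradient-tracking algorithm with each f_i convex and β-smooth (β > 0), and suppose f attains its minimum f* at some point x*. If 0 < η ≤ (1−σ)²/(160β), then for every t ≥ 0 the running averages x̂_i(t+1) = (1/(t+1)) Σ_{k=0}^{t} x_i(k+1) satisfy (1/n) Σ_{i=1}^n [ f(x̂_i(t+1)) − f* ] ≤ (1/(t+1)) · { ‖x̄(0) − x*‖²/(2η) + (36β/(1−σ)²) · [ (1/(β√n))‖s(0) − 𝟙g(0)‖ + (2/√n)‖x(0) − 𝟙x̄(0)‖ ]² }. -/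

import Mathlib

open scoped BigOperators RealInnerProductSpace
open Filter

noncomputable section

abbrev Vec (N : ℕ) := EuclideanSpace ℝ (Fin N)

/-- Frobenius norm of a stacked matrix in `ℝ^{n×N}`, viewed as `n` rows in `ℝ^N`. -/
def fro {n N : ℕ} (A : Fin n → Vec N) : ℝ := Real.sqrt (∑ i, ‖A i‖ ^ 2)

/-- Spectral norm (largest singular value) of a square real matrix, as the operator norm
of the induced linear map between Euclidean spaces. -/
def specNorm {n : ℕ} (M : Matrix (Fin n) (Fin n) ℝ) : ℝ :=
  ‖LinearMap.toContinuousLinearMap (Matrix.toEuclideanLin M)‖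

lemma hasDerivAt_comp_add_smul {E : Type*} [NormedAddCommGroup E] [InnerProductSpace ℝ E]
    [CompleteSpace E] {φ : E → ℝ} (hd : Differentiable ℝ φ) (u d : E) (t : ℝ) :
    HasDerivAt (fun t : ℝ => φ (u + t • d)) ⟪gradient φ (u + t • d), d⟫ t := by
  have h1 : HasDerivAt (fun t : ℝ => u + t • d) d t := by
    simpa using ((hasDerivAt_id t).smul_const d).const_add u
  have h2 := (hd (u + t • d)).hasGradientAt.hasFDerivAt.comp_hasDerivAt t h1
  rw [InnerProductSpace.toDual_apply_apply] at h2
  exact h2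

/-- First-order lower bound for convex functions. -/
lemma ConvexOn.add_inner_gradient_le {E : Type*} [NormedAddCommGroup E] [InnerProductSpace ℝ E]
    [CompleteSpace E] {φ : E → ℝ} (hc : ConvexOn ℝ Set.univ φ) (hd : Differentiable ℝ φ) (u v : E) :
    φ u + ⟪gradient φ u, v - u⟫ ≤ φ v := by
  have hconv : ConvexOn ℝ Set.univ (fun t : ℝ => φ (u + t • (v - u))) := by
    have h := hc.comp_affineMap (AffineMap.lineMap u v : ℝ →ᵃ[ℝ] E)
    have he : φ ∘ (AffineMap.lineMap u v : ℝ →ᵃ[ℝ] E) = fun t : ℝ => φ (u + t • (v - u)) := by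
      ext t
      simp [AffineMap.lineMap_apply, add_comm]
    rwa [he, Set.preimage_univ] at h
  have h := hconv.le_slope_of_hasDerivAt (Set.mem_univ 0) (Set.mem_univ 1) one_pos
    (hasDerivAt_comp_add_smul hd u (v - u) 0)
  rw [slope_def_field] at h
  simp only [zero_smul, add_zero, one_smul, add_sub_cancel, sub_zero, div_one] at h
  linarith

/-- The descent lemma: quadratic upper bound for functions with Lipschitz gradient. -/
lemma le_add_inner_gradient_add_sq {E : Type*} [NormedAddCommGroup E] [InnerProductSpace ℝ E]
    [CompleteSpace E] {φ : E → ℝ} {β : ℝ} (hd : Differentiable ℝ φ)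
    (hs : ∀ u v, ‖gradient φ u - gradient φ v‖ ≤ β * ‖u - v‖) (u v : E) :
    φ v ≤ φ u + ⟪gradient φ u, v - u⟫ + β / 2 * ‖v - u‖ ^ 2 := by
  obtain ⟨d, rfl⟩ : ∃ d, v = u + d := ⟨v - u, by abel⟩
  rw [add_sub_cancel_left]
  have hder : ∀ t : ℝ, HasDerivAt
      (fun t : ℝ => φ (u + t • d) - t * ⟪gradient φ u, d⟫ - β / 2 * ‖d‖ ^ 2 * t ^ 2)
      (⟪gradient φ (u + t • d), d⟫ - 1 * ⟪gradient φ u, d⟫ -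
        β / 2 * ‖d‖ ^ 2 * (2 * t)) t := by
    intro t
    have h4 : HasDerivAt (fun t : ℝ => β / 2 * ‖d‖ ^ 2 * t ^ 2) (β / 2 * ‖d‖ ^ 2 * (2 * t)) t := by
      simpa using (hasDerivAt_pow 2 t).const_mul (β / 2 * ‖d‖ ^ 2)
    exact ((hasDerivAt_comp_add_smul hd u d t).sub
      ((hasDerivAt_id t).mul_const ⟪gradient φ u, d⟫)).sub h4
  have hanti := antitoneOn_of_deriv_nonpos (convex_Icc (0 : ℝ) 1)
    (fun t _ => (hder t).continuousAt.continuousWithinAt)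
    (fun t _ => (hder t).differentiableAt.differentiableWithinAt) (by
      intro t ht
      rw [interior_Icc] at ht
      rw [(hder t).deriv, one_mul, ← inner_sub_left]
      have h1 := real_inner_le_norm (gradient φ (u + t • d) - gradient φ u) d
      have h2 := hs (u + t • d) u
      rw [add_sub_cancel_left, norm_smul, Real.norm_of_nonneg ht.1.le] at h2
      nlinarith [mul_le_mul_of_nonneg_right h2 (norm_nonneg d)])
  have h := hanti (Set.left_mem_Icc.2 zero_le_one) (Set.right_mem_Icc.2 zero_le_one) zero_le_one
  simp only [zero_smul, add_zero, one_smul] at h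
  linarith

lemma fro_nonneg {n N : ℕ} (A : Fin n → Vec N) : 0 ≤ fro A := Real.sqrt_nonneg _

lemma fro_sq {n N : ℕ} (A : Fin n → Vec N) : fro A ^ 2 = ∑ i, ‖A i‖ ^ 2 :=
  Real.sq_sqrt (Finset.sum_nonneg fun _ _ => sq_nonneg _)

lemma fro_eq_norm_toLp {n N : ℕ} (A : Fin n → Vec N) : fro A = ‖WithLp.toLp 2 A‖ := by
  rw [PiLp.norm_eq_of_L2]; rfl

lemma fro_add_le {n N : ℕ} (A B : Fin n → Vec N) : fro (A + B) ≤ fro A + fro B := by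
  simp only [fro_eq_norm_toLp, WithLp.toLp_add]
  exact norm_add_le _ _

lemma fro_neg {n N : ℕ} (A : Fin n → Vec N) : fro (-A) = fro A := by simp [fro]

lemma fro_smul {n N : ℕ} (c : ℝ) (A : Fin n → Vec N) : fro (c • A) = |c| * fro A := by
  simp only [fro_eq_norm_toLp, WithLp.toLp_smul, norm_smul, Real.norm_eq_abs]

lemma fro_const {n N : ℕ} (v : Vec N) : fro (fun _ : Fin n => v) = √n * ‖v‖ := by
  simp [fro, Real.sqrt_sq]

lemma fro_le_mul_fro {n N : ℕ} {A B : Fin n → Vec N} {c : ℝ} (hc : 0 ≤ c)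
    (h : ∀ i, ‖A i‖ ≤ c * ‖B i‖) : fro A ≤ c * fro B := by
  refine abs_le_of_sq_le_sq' ?_ (mul_nonneg hc (fro_nonneg _)) |>.2
  rw [mul_pow, fro_sq, fro_sq, Finset.mul_sum]
  refine Finset.sum_le_sum fun i _ => ?_
  rw [← mul_pow]
  exact pow_le_pow_left₀ (norm_nonneg _) (h i) 2

/-- The spectral norm controls the action of a matrix on the rows of a stacked matrix. -/
lemma fro_sum_smul_le {n N : ℕ} (M : Matrix (Fin n) (Fin n) ℝ) (A : Fin n → Vec N) :
    fro (fun i => ∑ j, M i j • A j) ≤ specNorm M * fro A := by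
  have hM : 0 ≤ specNorm M := norm_nonneg _
  refine abs_le_of_sq_le_sq' ?_ (mul_nonneg hM (fro_nonneg _)) |>.2
  rw [mul_pow, fro_sq, fro_sq]
  simp only [EuclideanSpace.norm_sq_eq]
  rw [Finset.sum_comm, Finset.sum_comm (γ := Fin n), Finset.mul_sum]
  refine Finset.sum_le_sum fun m _ => ?_
  have h := (LinearMap.toContinuousLinearMap (Matrix.toEuclideanLin M)).le_opNorm
    (WithLp.toLp 2 fun j => A j m)
  have h2 := pow_le_pow_left₀ (norm_nonneg _) h 2
  rw [mul_pow, EuclideanSpace.norm_sq_eq, EuclideanSpace.norm_sq_eq] at h2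
  simpa [Matrix.toLpLin_apply, Matrix.mulVec, dotProduct, specNorm] using h2

/-- Deviation of the rows of a stacked matrix from their mean. -/
def dev {n N : ℕ} (A : Fin n → Vec N) : Fin n → Vec N := fun i => A i - (n : ℝ)⁻¹ • ∑ j, A j

lemma sum_dev {n N : ℕ} (hn : 0 < n) (A : Fin n → Vec N) : ∑ i, dev A i = 0 := by
  have : (n : ℝ) ≠ 0 := by positivity
  simp [dev, Finset.sum_sub_distrib, ← Nat.cast_smul_eq_nsmul ℝ, smul_smul, this]

lemma dev_add {n N : ℕ} (A B : Fin n → Vec N) : dev (A + B) = dev A + dev B := by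
  ext1 i
  simp only [dev, Pi.add_apply, Finset.sum_add_distrib, smul_add]
  abel

lemma dev_smul {n N : ℕ} (c : ℝ) (A : Fin n → Vec N) : dev (c • A) = c • dev A := by
  ext1 i
  simp only [dev, Pi.smul_apply, ← Finset.smul_sum, smul_sub]
  rw [smul_comm]

/-- Parallel axis identity. -/
lemma sum_norm_sub_sq {n N : ℕ} (hn : 0 < n) (A : Fin n → Vec N) (w : Vec N) :
    ∑ i, ‖w - A i‖ ^ 2 = n * ‖w - (n : ℝ)⁻¹ • ∑ j, A j‖ ^ 2 + fro (dev A) ^ 2 := by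
  set m := (n : ℝ)⁻¹ • ∑ j, A j with hm
  have h : ∀ i, ‖w - A i‖ ^ 2 = ‖w - m‖ ^ 2 - 2 * ⟪w - m, dev A i⟫ + ‖dev A i‖ ^ 2 := by
    intro i
    rw [← norm_sub_sq_real]
    simp [dev, hm]
  rw [Finset.sum_congr rfl fun i _ => h i, fro_sq, Finset.sum_add_distrib,
    Finset.sum_sub_distrib, ← Finset.mul_sum, ← inner_sum, sum_dev hn]
  simp

lemma fro_dev_le {n N : ℕ} (hn : 0 < n) (A : Fin n → Vec N) : fro (dev A) ≤ fro A := by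
  refine abs_le_of_sq_le_sq' ?_ (fro_nonneg _) |>.2
  have h := sum_norm_sub_sq hn A 0
  simp only [zero_sub, norm_neg, ← fro_sq] at h
  have : 0 ≤ (n : ℝ) * ‖(n : ℝ)⁻¹ • ∑ j, A j‖ ^ 2 := by positivity
  linarith

lemma sum_mix {n N : ℕ} {W : Matrix (Fin n) (Fin n) ℝ} (hWcol : ∀ j, ∑ i, W i j = 1)
    (A : Fin n → Vec N) : ∑ i, ∑ j, W i j • A j = ∑ j, A j := by
  rw [Finset.sum_comm]
  simp [← Finset.sum_smul, hWcol]

/-- A doubly stochastic mixing step contracts the deviation from the mean. -/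
lemma fro_dev_mix_le {n N : ℕ} (hn : 0 < n) {W : Matrix (Fin n) (Fin n) ℝ}
    (hWrow : ∀ i, ∑ j, W i j = 1) (hWcol : ∀ j, ∑ i, W i j = 1) (A : Fin n → Vec N) :
    fro (dev fun i => ∑ j, W i j • A j) ≤
      specNorm (W - (n : ℝ)⁻¹ • Matrix.of (fun _ _ => (1 : ℝ))) * fro (dev A) := by
  refine le_of_eq_of_le (congrArg fro ?_) (fro_sum_smul_le _ (dev A))
  ext1 i
  simp only [Matrix.sub_apply, Matrix.smul_apply, Matrix.of_apply, sub_smul,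
    Finset.sum_sub_distrib, ← Finset.smul_sum, sum_dev hn, smul_zero, sub_zero]
  simp only [dev, sum_mix hWcol, smul_sub, Finset.sum_sub_distrib, ← Finset.sum_smul, hWrow,
    one_smul]

/-- Dissipation inequality for the consensus and tracking errors. -/
lemma consensus_dissipation {σ h a q w a' q' : ℝ} (hσ0 : 0 < σ) (hσ1 : σ < 1) (hh : 0 < h)
    (hh1 : h ≤ (1 - σ) ^ 2 / 160) (ha : 0 ≤ a) (hq : 0 ≤ q) (ha' : 0 ≤ a')
    (hq' : 0 ≤ q') (h1 : a' ≤ σ * a + h * q) (h2 : q' ≤ (σ + h) * q + 2 * a + h * w) :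
    a ^ 2 + a' ^ 2 ≤ 4 / (1 - σ) *
      ((a + (1 - σ) / 4 * q) ^ 2 - (a' + (1 - σ) / 4 * q') ^ 2) + h * (1 - h) * w ^ 2 := by
  obtain ⟨δ, rfl⟩ : ∃ δ, σ = 1 - δ := ⟨1 - σ, by ring⟩
  simp only [sub_sub_cancel] at *
  have hδ : 0 < δ := by linarith
  have hδ1 : δ < 1 := by linarith
  have hh2 : h ≤ δ / 160 := by nlinarith
  have hstep : a' + δ / 4 * q' ≤ (1 - δ / 2) * (a + δ / 4 * q) + δ / 4 * h * w := by
    have e1 : a' + δ / 4 * q' ≤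
        (1 - δ) * a + h * q + δ / 4 * ((1 - δ + h) * q + 2 * a + h * w) := by gcongr
    have e2 : h * q ≤ δ ^ 2 / 160 * q := by gcongr
    have e3 : δ / 4 * (h * q) ≤ δ / 4 * (δ / 160 * q) := by gcongr
    have e4 : 0 ≤ δ ^ 2 * q := by positivity
    linarith
  have haL : a ≤ a + δ / 4 * q := le_add_of_nonneg_right (by positivity)
  have haL' : a' ≤ a' + δ / 4 * q' := le_add_of_nonneg_right (by positivity)
  generalize a + δ / 4 * q = L at *
  generalize a' + δ / 4 * q' = L' at *
  have hsq : L' ^ 2 ≤ (1 - δ / 2) * L ^ 2 + δ / 8 * (h ^ 2 * w ^ 2) := by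
    have e1 : L' ^ 2 ≤ ((1 - δ / 2) * L + δ / 4 * h * w) ^ 2 :=
      pow_le_pow_left₀ (ha'.trans haL') hstep 2
    have e2 : 0 ≤ δ / 2 * (1 - δ / 2) * (L - h * w / 2) ^ 2 := by
      have : 0 ≤ 1 - δ / 2 := by linarith
      positivity
    linarith
  have hdiv : 2 * L ^ 2 - h ^ 2 * w ^ 2 / 2 ≤ 4 / δ * (L ^ 2 - L' ^ 2) := by
    rw [div_mul_eq_mul_div, le_div_iff₀ hδ]
    linarith
  have s1 : a ^ 2 ≤ L ^ 2 := pow_le_pow_left₀ ha haL 2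
  have s2 : a' ^ 2 ≤ L' ^ 2 := pow_le_pow_left₀ ha' haL' 2
  have h5 : h ^ 2 * w ^ 2 ≤ h * (1 - h) * w ^ 2 := by
    gcongr
    nlinarith
  have h6 : δ * (h ^ 2 * w ^ 2) ≤ 1 * (h ^ 2 * w ^ 2) := by gcongr
  have h7 : 0 ≤ δ * L ^ 2 := by positivity
  have h8 : 0 ≤ h ^ 2 * w ^ 2 := by positivity
  linarith

/-- One-step inequality for the average of smooth convex functions, with the gradients evaluated
at the rows of a stacked matrix. -/
lemma average_sub_le {n N : ℕ} (hn : 0 < n) {β : ℝ} {f : Fin n → Vec N → ℝ}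
    (hcvx : ∀ i, ConvexOn ℝ Set.univ (f i)) (hdiff : ∀ i, Differentiable ℝ (f i))
    (hsmooth : ∀ i, ∀ u v : Vec N, ‖gradient (f i) u - gradient (f i) v‖ ≤ β * ‖u - v‖)
    (A : Fin n → Vec N) (u v : Vec N) :
    (n : ℝ)⁻¹ * ∑ i, f i u - (n : ℝ)⁻¹ * ∑ i, f i v ≤
      ⟪(n : ℝ)⁻¹ • ∑ i, gradient (f i) (A i), u - v⟫ +
        β / 2 * ‖u - (n : ℝ)⁻¹ • ∑ j, A j‖ ^ 2 + β / (2 * n) * fro (dev A) ^ 2 := by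
  have hn' : (0 : ℝ) < n := by positivity
  have h : ∀ i, f i u - f i v ≤ ⟪gradient (f i) (A i), u - v⟫ + β / 2 * ‖u - A i‖ ^ 2 := by
    intro i
    have h1 := (hcvx i).add_inner_gradient_le (hdiff i) (A i) v
    have h2 := le_add_inner_gradient_add_sq (hdiff i) (hsmooth i) (A i) u
    have h3 : ⟪gradient (f i) (A i), u - v⟫ =
        ⟪gradient (f i) (A i), u - A i⟫ - ⟪gradient (f i) (A i), v - A i⟫ := by
      rw [← inner_sub_right, sub_sub_sub_cancel_right]
    linarith
  have hsum := Finset.sum_le_sum fun i (_ : i ∈ Finset.univ) => h i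
  rw [Finset.sum_sub_distrib, Finset.sum_add_distrib, ← sum_inner, ← Finset.mul_sum,
    sum_norm_sub_sq hn] at hsum
  rw [← mul_sub, real_inner_smul_left]
  refine (mul_le_mul_of_nonneg_left hsum (inv_nonneg.2 hn'.le)).trans_eq ?_
  field_simp
  ring

/-- Averaging a smooth function over the rows of a stacked matrix exceeds its value at the mean
by at most a multiple of the squared deviation. -/
lemma sum_le_mean_add {n N : ℕ} (hn : 0 < n) {β : ℝ} {φ : Vec N → ℝ}
    (hd : Differentiable ℝ φ) (hs : ∀ u v, ‖gradient φ u - gradient φ v‖ ≤ β * ‖u - v‖)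
    (A : Fin n → Vec N) :
    ∑ i, φ (A i) ≤ n * φ ((n : ℝ)⁻¹ • ∑ j, A j) + β / 2 * fro (dev A) ^ 2 := by
  set m := (n : ℝ)⁻¹ • ∑ j, A j
  have hsum := Finset.sum_le_sum fun i (_ : i ∈ Finset.univ) =>
    le_add_inner_gradient_add_sq hd hs m (A i)
  have h0 : ∑ i, (A i - m) = 0 := sum_dev hn A
  rw [Finset.sum_add_distrib, Finset.sum_add_distrib, ← inner_sum, h0, ← Finset.mul_sum] at hsum
  have h1 : fro (dev A) ^ 2 = ∑ i, ‖A i - m‖ ^ 2 := fro_sq _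
  rw [h1]
  simpa using hsum

theorem statement11
    {n N : ℕ} (hn : 0 < n)
    (β : ℝ) (hβ : 0 < β)
    (f : Fin n → Vec N → ℝ)
    (hcvx : ∀ i, ConvexOn ℝ Set.univ (f i))
    (hdiff : ∀ i, Differentiable ℝ (f i))
    (hsmooth : ∀ i, ∀ u v : Vec N,
      ‖gradient (f i) u - gradient (f i) v‖ ≤ β * ‖u - v‖)
    (favg : Vec N → ℝ) (hfavg : ∀ z, favg z = (n : ℝ)⁻¹ * ∑ i, f i z)
    (xstar : Vec N) (hmin : ∀ z, favg xstar ≤ favg z)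
    (W : Matrix (Fin n) (Fin n) ℝ)
    (hWnonneg : ∀ i j, 0 ≤ W i j)
    (hWrow : ∀ i, ∑ j, W i j = 1)
    (hWcol : ∀ j, ∑ i, W i j = 1)
    (σ : ℝ)
    (hσ : σ = specNorm (W - (n : ℝ)⁻¹ • Matrix.of (fun _ _ => (1 : ℝ))))
    (hσ0 : 0 < σ) (hσ1 : σ < 1)
    (η : ℝ) (hη0 : 0 < η) (hη1 : η ≤ (1 - σ) ^ 2 / (160 * β))
    (x s : ℕ → Fin n → Vec N)
    (hs0 : ∀ i, s 0 i = gradient (f i) (x 0 i))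
    (hxupd : ∀ t i, x (t + 1) i = (∑ j, W i j • x t j) - η • s t i)
    (hsupd : ∀ t i, s (t + 1) i =
      (∑ j, W i j • s t j) + gradient (f i) (x (t + 1) i) - gradient (f i) (x t i))
    (xbar g : ℕ → Vec N)
    (hxbar : ∀ t, xbar t = (n : ℝ)⁻¹ • ∑ i, x t i)
    (hg : ∀ t, g t = (n : ℝ)⁻¹ • ∑ i, gradient (f i) (x t i))
    (xhat : Fin n → ℕ → Vec N)
    (hxhat : ∀ i t, xhat i (t + 1) = ((t : ℝ) + 1)⁻¹ • ∑ k ∈ Finset.range (t + 1), x (k + 1) i) :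
    ∀ t : ℕ,
      (n : ℝ)⁻¹ * ∑ i, (favg (xhat i (t + 1)) - favg xstar) ≤
        ((t : ℝ) + 1)⁻¹ *
          (‖xbar 0 - xstar‖ ^ 2 / (2 * η) +
            36 * β / (1 - σ) ^ 2 *
              ((1 / (β * Real.sqrt n)) * fro (fun i => s 0 i - g 0) +
                (2 / Real.sqrt n) * fro (fun i => x 0 i - xbar 0)) ^ 2) := by
  have hn' : (0 : ℝ) < n := by positivity
  have hδ : 0 < 1 - σ := by linarith
  have hmean_s : ∀ t, (n : ℝ)⁻¹ • ∑ i, s t i = g t := by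
    intro t
    induction t with
    | zero => simp only [hg, hs0]
    | succ t ih =>
      simp only [hsupd, Finset.sum_sub_distrib, Finset.sum_add_distrib, sum_mix hWcol, smul_sub,
        smul_add, ih]
      rw [hg, hg]
      abel
  have hdev_x : ∀ t, (fun i => x t i - xbar t) = dev (x t) := by
    intro t; ext1 i; rw [hxbar]; rfl
  have hdev_s : ∀ t, (fun i => s t i - g t) = dev (s t) := by
    intro t; ext1 i; rw [← hmean_s]; rfl
  have hxbar_succ : ∀ t, xbar (t + 1) = xbar t - η • g t := by
    intro t
    rw [hxbar, hxbar, ← hmean_s]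
    simp only [hxupd, Finset.sum_sub_distrib, sum_mix hWcol, smul_sub, ← Finset.smul_sum]
    rw [smul_comm η]
  have hmix : ∀ A : Fin n → Vec N, fro (dev fun i => ∑ j, W i j • A j) ≤ σ * fro (dev A) := by
    intro A; rw [hσ]; exact fro_dev_mix_le hn hWrow hWcol A
  have hcons : ∀ t, fro (dev (x (t + 1))) ≤ σ * fro (dev (x t)) + η * fro (dev (s t)) := by
    intro t
    have he : x (t + 1) = (fun i => ∑ j, W i j • x t j) + (-η) • s t := by
      ext1 i; simp [hxupd, sub_eq_add_neg]
    rw [he, dev_add, dev_smul]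
    refine (fro_add_le _ _).trans ?_
    rw [fro_smul, abs_neg, abs_of_pos hη0]
    gcongr
    exact hmix _
  have hdisp : ∀ t, fro (x (t + 1) - x t) ≤
      2 * fro (dev (x t)) + η * fro (dev (s t)) + η * (√n * ‖g t‖) := by
    intro t
    have he : x (t + 1) - x t = (dev fun i => ∑ j, W i j • x t j) + -dev (x t) +
        (-η) • dev (s t) + (-η) • fun _ => g t := by
      ext1 i
      simp only [Pi.add_apply, Pi.sub_apply, Pi.neg_apply, Pi.smul_apply, dev, sum_mix hWcol,
        hmean_s, hxupd, smul_sub, neg_smul]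
      abel
    rw [he]
    refine (fro_add_le _ _).trans ?_
    rw [fro_smul, fro_const, abs_neg, abs_of_pos hη0]
    gcongr
    refine (fro_add_le _ _).trans ?_
    rw [fro_smul, abs_neg, abs_of_pos hη0]
    gcongr
    refine (fro_add_le _ _).trans ?_
    rw [fro_neg]
    nlinarith [hmix (x t), fro_nonneg (dev (x t))]
  have htrack : ∀ t, fro (dev (s (t + 1))) ≤
      σ * fro (dev (s t)) + β * fro (x (t + 1) - x t) := by
    intro t
    have he : s (t + 1) = (fun i => ∑ j, W i j • s t j) +
        fun i => gradient (f i) (x (t + 1) i) - gradient (f i) (x t i) := by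
      ext1 i; simp [hsupd, add_sub_assoc]
    rw [he, dev_add]
    refine (fro_add_le _ _).trans (add_le_add (hmix _) ((fro_dev_le hn _).trans ?_))
    exact fro_le_mul_fro hβ.le fun i => hsmooth i _ _
  set L : ℕ → ℝ := fun t => fro (dev (x t)) + (1 - σ) / 4 * (fro (dev (s t)) / β) with hL
  have hdiss : ∀ t, fro (dev (x t)) ^ 2 + fro (dev (x (t + 1))) ^ 2 ≤
      4 / (1 - σ) * (L t ^ 2 - L (t + 1) ^ 2) +
        β * η * (1 - β * η) * (√n * ‖g t‖ / β) ^ 2 := by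
    intro t
    refine consensus_dissipation hσ0 hσ1 (by positivity) ?_ (fro_nonneg _)
      (div_nonneg (fro_nonneg _) hβ.le) (fro_nonneg _)
      (div_nonneg (fro_nonneg _) hβ.le) ?_ ?_
    · calc β * η ≤ β * ((1 - σ) ^ 2 / (160 * β)) := by gcongr
        _ = (1 - σ) ^ 2 / 160 := by field_simp
    · convert hcons t using 2
      field_simp
    · rw [div_le_iff₀ hβ]
      calc fro (dev (s (t + 1))) ≤ σ * fro (dev (s t)) + β * (2 * fro (dev (x t)) +
            η * fro (dev (s t)) + η * (√n * ‖g t‖)) := (htrack t).trans (by gcongr; exact hdisp t)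
        _ = _ := by field_simp; ring
  set V : ℕ → ℝ := fun t => ‖xbar t - xstar‖ ^ 2 / (2 * η) + 2 * β / (n * (1 - σ)) * L t ^ 2
    with hV
  have hstep : ∀ t, (n : ℝ)⁻¹ * ∑ i, (favg (x (t + 1) i) - favg xstar) ≤ V t - V (t + 1) := by
    intro t
    have h1 : (n : ℝ)⁻¹ * ∑ i, favg (x (t + 1) i) ≤
        favg (xbar (t + 1)) + β / (2 * n) * fro (dev (x (t + 1))) ^ 2 := by
      have h := Finset.sum_le_sum fun j (_ : j ∈ Finset.univ) =>
        sum_le_mean_add hn (hdiff j) (hsmooth j) (x (t + 1))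
      rw [Finset.sum_add_distrib, ← Finset.mul_sum, ← hxbar] at h
      simp only [Finset.sum_const, Finset.card_univ, Fintype.card_fin, nsmul_eq_mul] at h
      simp only [hfavg]
      rw [← Finset.mul_sum, Finset.sum_comm]
      calc (n : ℝ)⁻¹ * ((n : ℝ)⁻¹ * ∑ j, ∑ i, f j (x (t + 1) i)) ≤ (n : ℝ)⁻¹ * ((n : ℝ)⁻¹ *
            (n * ∑ i, f i (xbar (t + 1)) + n * (β / 2 * fro (dev (x (t + 1))) ^ 2))) := by gcongr
        _ = _ := by field_simp
    have h2 := average_sub_le hn hcvx hdiff hsmooth (x t) (xbar (t + 1)) xstar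
    rw [← hfavg, ← hfavg, ← hg, ← hxbar] at h2
    have h3 : ‖xbar (t + 1) - xbar t‖ ^ 2 = η ^ 2 * ‖g t‖ ^ 2 := by
      rw [hxbar_succ, sub_sub_cancel_left, norm_neg, norm_smul, mul_pow, Real.norm_eq_abs, sq_abs]
    have h4 : xbar (t + 1) - xstar = (xbar t - xstar) - η • g t := by
      rw [hxbar_succ]; abel
    have h5 : ⟪g t, xbar (t + 1) - xstar⟫ = (‖xbar t - xstar‖ ^ 2 -
        ‖xbar (t + 1) - xstar‖ ^ 2) / (2 * η) - η / 2 * ‖g t‖ ^ 2 := by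
      rw [h4, norm_sub_sq_real (xbar t - xstar), inner_sub_right, real_inner_smul_right,
        real_inner_smul_right, real_inner_self_eq_norm_sq, norm_smul, real_inner_comm,
        Real.norm_of_nonneg hη0.le]
      field_simp
      ring
    have h6 : β / (2 * n) * (fro (dev (x t)) ^ 2 + fro (dev (x (t + 1))) ^ 2) ≤
        2 * β / (n * (1 - σ)) * (L t ^ 2 - L (t + 1) ^ 2) +
          η / 2 * (1 - β * η) * ‖g t‖ ^ 2 := by
      refine (mul_le_mul_of_nonneg_left (hdiss t) (by positivity)).trans_eq ?_
      rw [div_pow, mul_pow, Real.sq_sqrt hn'.le]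
      field_simp
      ring
    have h7 : (n : ℝ)⁻¹ * ∑ i, (favg (x (t + 1) i) - favg xstar) =
        (n : ℝ)⁻¹ * ∑ i, favg (x (t + 1) i) - favg xstar := by
      rw [Finset.sum_sub_distrib, mul_sub]
      simp [hn'.ne']
    rw [h3, h5] at h2
    rw [h7]
    simp only [hV]
    rw [sub_div] at h2
    linarith
  have hconv : ConvexOn ℝ Set.univ favg := by
    refine ⟨convex_univ, fun u _ v _ a b ha hb hab => ?_⟩
    simp only [hfavg, smul_eq_mul]
    rw [mul_left_comm a, mul_left_comm b, ← mul_add, Finset.mul_sum _ _ a, Finset.mul_sum _ _ b,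
      ← Finset.sum_add_distrib]
    gcongr with i
    exact (hcvx i).2 trivial trivial ha hb hab
  intro t
  have hjensen : ∀ i, favg (xhat i (t + 1)) ≤
      ((t : ℝ) + 1)⁻¹ * ∑ k ∈ Finset.range (t + 1), favg (x (k + 1) i) := by
    intro i
    rw [hxhat, Finset.smul_sum, Finset.mul_sum]
    refine hconv.map_sum_le (fun _ _ => by positivity) ?_ fun _ _ => trivial
    simp
    field_simp
  have hV0 : V 0 ≤ ‖xbar 0 - xstar‖ ^ 2 / (2 * η) + 36 * β / (1 - σ) ^ 2 *
      ((1 / (β * Real.sqrt n)) * fro (fun i => s 0 i - g 0) +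
        (2 / Real.sqrt n) * fro (fun i => x 0 i - xbar 0)) ^ 2 := by
    rw [hdev_x, hdev_s]
    simp only [hV, hL]
    refine add_le_add le_rfl ?_
    have ha := fro_nonneg (dev (x 0))
    have hq : 0 ≤ fro (dev (s 0)) / β := div_nonneg (fro_nonneg _) hβ.le
    have he : (1 / (β * √n)) * fro (dev (s 0)) + (2 / √n) * fro (dev (x 0)) =
        (2 * fro (dev (x 0)) + fro (dev (s 0)) / β) / √n := by
      field_simp
      ring
    rw [he, div_pow, Real.sq_sqrt hn'.le]
    calc 2 * β / (n * (1 - σ)) * (fro (dev (x 0)) + (1 - σ) / 4 * (fro (dev (s 0)) / β)) ^ 2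
        ≤ 36 * β / (n * (1 - σ) ^ 2) * (2 * fro (dev (x 0)) + fro (dev (s 0)) / β) ^ 2 := by
          gcongr
          · norm_num
          · nlinarith
          · linarith
          · nlinarith
      _ = _ := by field_simp
  have hVnonneg : 0 ≤ V (t + 1) := by
    simp only [hV]
    positivity
  calc (n : ℝ)⁻¹ * ∑ i, (favg (xhat i (t + 1)) - favg xstar)
      ≤ (n : ℝ)⁻¹ * ∑ i, (((t : ℝ) + 1)⁻¹ *
          ∑ k ∈ Finset.range (t + 1), (favg (x (k + 1) i) - favg xstar)) := by
        gcongr with i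
        rw [Finset.sum_sub_distrib, mul_sub]
        refine sub_le_sub (hjensen i) (le_of_eq ?_)
        simp
        field_simp
    _ = ((t : ℝ) + 1)⁻¹ * ∑ k ∈ Finset.range (t + 1),
          (n : ℝ)⁻¹ * ∑ i, (favg (x (k + 1) i) - favg xstar) := by
        rw [← Finset.mul_sum, ← Finset.mul_sum, Finset.sum_comm, mul_left_comm]
    _ ≤ ((t : ℝ) + 1)⁻¹ * ∑ k ∈ Finset.range (t + 1), (V k - V (k + 1)) := by
        gcongr with k
        exact hstep k
    _ ≤ _ := by
        rw [Finset.sum_range_sub']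
        gcongr
        linarith
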